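/- arXiv:0911.4008 — 3 statements merged into one kernel-verified Lean document; each statement's English description precedes it below -/
import Mathlib

section
/- Let $H$ be an $n$-balanced $3$-partite $3$-graph with sides $V_1, V_2, V_3$. Suppose that every pair $(u,v) \in V_2 \times V_3$ has degree strictly greater than $n/2$ in $H$, and every pair $(u,v) \in V_1 \times V_2$ has degree at least $n/2$ in $H$. Then $H$ has a perfect matching. -/
/-- A perfect matching of a 3-partite 3-graph with edge set `E ⊆ V1 × V2 × V3`:
a subset of `E` such that every vertex of each side lies in exactly one of its edges
(this forces the edges to be pairwise disjoint and to cover all vertices). -/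
def IsPerfectMatching3 {V1 V2 V3 : Type*}
    (E M : Finset (V1 × V2 × V3)) : Prop :=
  M ⊆ E ∧
    (∀ v : V1, ∃! e, e ∈ M ∧ e.1 = v) ∧
    (∀ v : V2, ∃! e, e ∈ M ∧ e.2.1 = v) ∧
    (∀ v : V3, ∃! e, e ∈ M ∧ e.2.2 = v)

open Finset in
/-- A permutation carrying `P` onto `C`, with one prescribed value inside `C` and one outside. -/
lemma exists_perm_mem_iff {ι : Type*} [Fintype ι] [DecidableEq ι] {P C : Finset ι}
    (h : #P = #C) {a b c w : ι} (ha : a ∈ P) (hb : b ∉ P) (hc : c ∈ C) (hw : w ∉ C) :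
    ∃ τ : Equiv.Perm ι, τ a = c ∧ τ b = w ∧ ∀ i, τ i ∈ C ↔ i ∈ P := by
  have e : {i // i ∈ P} ≃ {i // i ∈ C} := Finset.equivOfCardEq h
  let τ₀ : Equiv.Perm ι := e.extendSubtype
  have h₀ : ∀ i, τ₀ i ∈ C ↔ i ∈ P := fun i ↦
    ⟨fun hi ↦ by_contra fun hn ↦ e.extendSubtype_not_mem i hn hi, e.extendSubtype_mem i⟩
  have h_swap : ∀ x y : ι, (x ∈ C ↔ y ∈ C) → ∀ i, Equiv.swap x y i ∈ C ↔ i ∈ C := by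
    intro x y hxy i
    by_cases h1 : i = x
    · subst h1; simp [hxy]
    by_cases h2 : i = y
    · subst h2; simp [hxy]
    rw [Equiv.swap_apply_of_ne_of_ne h1 h2]
  have ha' := (h₀ a).2 ha
  have hb' : τ₀ b ∉ C := fun hh ↦ hb ((h₀ b).1 hh)
  refine ⟨(τ₀.trans (Equiv.swap (τ₀ a) c)).trans (Equiv.swap (τ₀ b) w), ?_, ?_, ?_⟩
  · simp only [Equiv.trans_apply, Equiv.swap_apply_left]
    apply Equiv.swap_apply_of_ne_of_ne <;> rintro rfl <;> contradiction
  · simp only [Equiv.trans_apply]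
    rw [Equiv.swap_apply_of_ne_of_ne (a := τ₀ a), Equiv.swap_apply_left]
    · intro hh; rw [hh] at hb'; contradiction
    · intro hh; rw [hh] at hb'; contradiction
  · intro i
    simp only [Equiv.trans_apply]
    rw [h_swap _ _ (by tauto), h_swap _ _ (by tauto), h₀]

open Finset in
/-- A system of distinct representatives for sets that, up to one exception on each side,
contain `C` (for the indices in `P`) or the complement of `C` (for the others). -/
lemma exists_perm_mem_of_split {ι : Type*} [Fintype ι] [DecidableEq ι] {P C : Finset ι}
    (h : #P = #C) {F : ι → Finset ι} {a b : ι} (ha : a ∈ P) (hb : b ∉ P)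
    (hFa : ∃ c ∈ F a, c ∈ C) (hFb : ∃ w ∈ F b, w ∉ C)
    (hP : ∀ i ∈ P, i ≠ a → F i = C) (hQ : ∀ i ∉ P, i ≠ b → F i = Cᶜ) :
    ∃ τ : Equiv.Perm ι, ∀ i, τ i ∈ F i := by
  obtain ⟨c, hca, hc⟩ := hFa
  obtain ⟨w, hwb, hw⟩ := hFb
  obtain ⟨τ, rfl, rfl, hτ⟩ := exists_perm_mem_iff h ha hb hc hw
  refine ⟨τ, fun i ↦ ?_⟩
  by_cases hia : i = a
  · rwa [hia]
  by_cases hib : i = b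
  · rwa [hib]
  by_cases hi : i ∈ P
  · rw [hP i hi hia, hτ]; exact hi
  · rw [hQ i hi hib, mem_compl, hτ]; exact hi

open Finset in
lemma eq_of_forall_mem_of_card_half {ι : Type*} [Fintype ι] {A C : Finset ι}
    (hC : 2 * #C = Fintype.card ι) (hA : Fintype.card ι ≤ 2 * #A)
    (h : ¬ ∃ y ∈ A, y ∉ C) : A = C := by
  push Not at h
  exact Finset.eq_of_subset_of_card_le h (by omega)

open Finset in
/-- The extremal configuration: all neighbourhoods `N i i` are one of the two halves `C`, `Cᶜ`
of the index set, with `C` occurring once too often. -/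
lemma exists_perm_of_halves {ι : Type*} [Fintype ι] [DecidableEq ι] (N : ι → ι → Finset ι)
    (hrow : ∀ c x, Fintype.card ι ≤ 2 * #(N c x))
    (hcol : ∀ c y, Fintype.card ι < 2 * #{x | y ∈ N c x})
    {P C : Finset ι} (hC : 2 * #C = Fintype.card ι) (hPC : #P = #C + 1)
    (hP : ∀ i ∈ P, N i i = C) (hQ : ∀ i ∉ P, N i i = Cᶜ) :
    ∃ σ τ : Equiv.Perm ι, ∀ c, τ c ∈ N c (σ c) := by
  by_contra hno
  have hC' : 2 * #Cᶜ = Fintype.card ι := by rw [card_compl]; omega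
  have eqC : ∀ c x, (¬ ∃ y ∈ N c x, y ∉ C) → N c x = C := fun c x h ↦
    eq_of_forall_mem_of_card_half hC (hrow c x) h
  have eqW : ∀ c x, (¬ ∃ y ∈ N c x, y ∈ C) → N c x = Cᶜ := fun c x h ↦
    eq_of_forall_mem_of_card_half hC' (hrow c x) (by simpa using h)
  have hPle : #P ≤ Fintype.card ι := card_le_univ P
  have Cne : C.Nonempty := card_pos.1 (by omega)
  have Wne : Cᶜ.Nonempty := card_pos.1 (by omega)
  have key : ∀ s ∈ P, ∀ j ∈ P, s ≠ j → (∃ y ∈ N s j, y ∉ C) → N j s = Cᶜ := by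
    intro s hs j hj hsj hW
    by_contra hne
    have hh : ∃ y ∈ N j s, y ∈ C := by_contra fun h ↦ hne (eqW _ _ h)
    apply hno
    refine ⟨Equiv.swap s j, exists_perm_mem_of_split (P := P.erase s) (C := C) (a := j) (b := s)
      (by rw [card_erase_of_mem hs]; omega) (by simp [hj, hsj.symm]) (by simp)
      (by simpa using hh) (by simpa using hW) ?_ ?_⟩
    · intro i hi hij
      rw [mem_erase] at hi
      rw [Equiv.swap_apply_of_ne_of_ne hi.1 hij]
      exact hP i hi.2
    · intro i hi his
      have hi' : i ∉ P := fun h ↦ hi (mem_erase.2 ⟨his, h⟩)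
      rw [Equiv.swap_apply_of_ne_of_ne his (by rintro rfl; contradiction)]
      exact hQ i hi'
  have hdich : ∀ s ∈ P, ∀ j ∈ P, s ≠ j → N s j = C ∨ (N s j = Cᶜ ∧ N j s = Cᶜ) := by
    intro s hs j hj hsj
    by_cases h : ∃ y ∈ N s j, y ∉ C
    · right
      have h1 := key s hs j hj hsj h
      refine ⟨key j hj s hs hsj.symm ?_, h1⟩
      obtain ⟨w, hw⟩ := Wne
      exact ⟨w, h1 ▸ hw, mem_compl.1 hw⟩
    · exact .inl (eqC _ _ h)
  obtain ⟨j, hj⟩ : P.Nonempty := card_pos.1 (by omega)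
  obtain ⟨w, hw⟩ := Wne
  obtain ⟨c, hc⟩ := Cne
  rw [mem_compl] at hw
  obtain ⟨s, hs, hsj, hjs⟩ : ∃ s ∈ P, s ≠ j ∧ N s j = Cᶜ := by
    by_contra! hh
    have hsub : ({x | w ∈ N j x} : Finset ι) ⊆ Pᶜ := by
      intro x hx
      rw [mem_filter] at hx
      rw [mem_compl]
      intro hxP
      by_cases hxj : x = j
      · subst hxj; rw [hP x hxP] at hx; exact hw hx.2
      · rcases hdich j hj x hxP (Ne.symm hxj) with h | h
        · rw [h] at hx; exact hw hx.2
        · exact hh x hxP hxj h.2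
    have h1 := card_le_card hsub
    have h2 := hcol j w
    rw [card_compl] at h1
    omega
  obtain ⟨q, hqC, hqW⟩ : ∃ q, (∃ y ∈ N j q, y ∈ C) ∧ (∃ y ∈ N j q, y ∉ C) := by
    by_contra! hh
    have hdisj : Disjoint ({x | w ∈ N j x} : Finset ι) ({x | c ∈ N j x} : Finset ι) := by
      rw [disjoint_left]
      intro x hx hx'
      rw [mem_filter] at hx hx'
      exact hw (hh x ⟨c, hx'.2, hc⟩ w hx.2)
    have h1 := card_le_univ (({x | w ∈ N j x} : Finset ι) ∪ ({x | c ∈ N j x} : Finset ι))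
    rw [card_union_of_disjoint hdisj] at h1
    have h2 := hcol j w
    have h3 := hcol j c
    omega
  have hqP : q ∉ P := by
    intro hqP
    obtain ⟨y, hy, hyC⟩ := hqC
    obtain ⟨z, hz, hzC⟩ := hqW
    by_cases hqj : q = j
    · subst hqj; rw [hP q hqP] at hz; contradiction
    · rcases hdich j hj q hqP (Ne.symm hqj) with h | h
      · rw [h] at hz; contradiction
      · rw [h.1, mem_compl] at hy; contradiction
  have hqs : q ≠ s := by rintro rfl; contradiction
  have hqj : q ≠ j := by rintro rfl; contradiction
  let σ : Equiv.Perm ι := (Equiv.swap s j).trans (Equiv.swap s q)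
  have σs : σ s = j := by
    simp [σ, Equiv.swap_apply_of_ne_of_ne hsj.symm hqj.symm]
  have σj : σ j = q := by simp [σ]
  have σq : σ q = s := by simp [σ, Equiv.swap_apply_of_ne_of_ne hqs hqj]
  have σi : ∀ i, i ≠ s → i ≠ j → i ≠ q → σ i = i := by
    intro i h1 h2 h3
    simp [σ, Equiv.swap_apply_of_ne_of_ne h1 h2, Equiv.swap_apply_of_ne_of_ne h1 h3]
  apply hno
  refine ⟨σ, ?_⟩
  by_cases hqsC : ∃ y ∈ N q s, y ∈ C
  · refine exists_perm_mem_of_split (P := insert q ((P.erase s).erase j)) (C := C)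
      (a := q) (b := j) ?_ (by simp) (by simp [hqj.symm]) (by rwa [σq]) (by rwa [σj]) ?_ ?_
    · rw [card_insert_of_notMem (by simp [hqP]), card_erase_of_mem (by simp [hj, hsj.symm]),
        card_erase_of_mem hs]
      omega
    · intro i hi hiq
      simp only [mem_insert, mem_erase] at hi
      obtain ⟨h1, h2, h3⟩ := hi.resolve_left hiq
      rw [σi i h2 h1 hiq]
      exact hP i h3
    · intro i hi hij
      simp only [mem_insert, mem_erase, not_or] at hi
      by_cases his : i = s
      · rw [his, σs, hjs]
      · rw [σi i his hij hi.1]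
        exact hQ i (by tauto)
  · have hqsW : N q s = Cᶜ := eqW _ _ hqsC
    refine exists_perm_mem_of_split (P := P.erase s) (C := C)
      (a := j) (b := q) ?_ (by simp [hj, hsj.symm]) (by simp [hqP]) (by rwa [σj])
      ⟨w, by rw [σq, hqsW, mem_compl]; exact hw, hw⟩ ?_ ?_
    · rw [card_erase_of_mem hs]
      omega
    · intro i hi hij
      rw [mem_erase] at hi
      rw [σi i hi.1 hij (by rintro rfl; exact hqP hi.2)]
      exact hP i hi.2
    · intro i hi hiq
      rw [mem_erase] at hi
      by_cases his : i = s
      · rw [his, σs, hjs]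
      · rw [σi i his (by rintro rfl; tauto) hiq]
        exact hQ i (by tauto)

open Finset in
/-- Inside a minimal nonempty closed set of indices avoiding `s`, the value at one index can be
prescribed. -/
lemma exists_perm_of_minimal_closed {ι : Type*} [Fintype ι] [DecidableEq ι] {F : ι → Finset ι}
    {R : Finset ι} (hR : R.biUnion F ⊆ R) (hF : ∀ i ∈ R, i ∈ F i)
    (hmin : ∀ A ⊂ R, A.biUnion F ⊆ A → A = ∅) {j c : ι} (hj : j ∈ R) (hc : c ∈ R) :
    ∃ τ : Equiv.Perm ι, τ j = c ∧ (∀ i ∈ R, i ≠ j → τ i ∈ F i) ∧ ∀ i ∉ R, τ i = i := by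
  have hall : ∀ A : Finset {i // i ∈ R ∧ i ≠ j}, #A ≤ #(A.biUnion fun i ↦ (F i).erase c) := by
    intro A
    let B : Finset ι := A.map (Function.Embedding.subtype _)
    have hB : ∀ i ∈ B, i ∈ R ∧ i ≠ j := by
      intro i hi
      obtain ⟨x, -, rfl⟩ := mem_map.1 hi
      exact x.2
    have hBA : (A.biUnion fun i ↦ (F i).erase c) = (B.biUnion F).erase c := by
      ext y
      simp only [B, mem_biUnion, mem_erase, mem_map, Function.Embedding.coe_subtype]
      constructor
      · rintro ⟨i, hi, hy, hyi⟩; exact ⟨hy, i, ⟨i, hi, rfl⟩, hyi⟩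
      · rintro ⟨hy, _, ⟨i, hi, rfl⟩, hyi⟩; exact ⟨i, hi, hy, hyi⟩
    have hcard : #A = #B := (card_map _).symm
    rw [hBA, hcard]
    have hsub : B ⊆ B.biUnion F := fun i hi ↦ mem_biUnion.2 ⟨i, hi, hF i (hB i hi).1⟩
    by_contra! hlt
    have h1 := card_le_card hsub
    have h2 := pred_card_le_card_erase (s := B.biUnion F) (a := c)
    have heq : B = B.biUnion F := eq_of_subset_of_card_le hsub (by omega)
    have hempty := hmin B ⟨fun i hi ↦ (hB i hi).1, fun h ↦ (hB j (h hj)).2 rfl⟩ heq.ge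
    rw [hempty] at hlt
    simp at hlt
  obtain ⟨f, hf, hfF⟩ := (Finset.all_card_le_biUnion_card_iff_exists_injective _).1 hall
  let g : ι → ι := fun i ↦ if hi : i ∈ R ∧ i ≠ j then f ⟨i, hi⟩ else if i = j then c else i
  have gj : g j = c := by simp [g]
  have gR : ∀ i (h1 : i ∈ R) (h2 : i ≠ j), g i = f ⟨i, h1, h2⟩ := by
    intro i h1 h2; simp [g, h1, h2]
  have gU : ∀ i ∉ R, g i = i := by
    intro i h1
    have : i ≠ j := by rintro rfl; contradiction
    simp [g, h1, this]
  have gmem : ∀ i (h1 : i ∈ R) (h2 : i ≠ j), g i ∈ F i ∧ g i ≠ c ∧ g i ∈ R := by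
    intro i h1 h2
    rw [gR i h1 h2]
    have := mem_erase.1 (hfF ⟨i, h1, h2⟩)
    exact ⟨this.2, this.1, hR (mem_biUnion.2 ⟨i, h1, this.2⟩)⟩
  have ginj : Function.Injective g := by
    intro x y hxy
    by_cases hx : x ∈ R <;> by_cases hy : y ∈ R
    · by_cases hxj : x = j <;> by_cases hyj : y = j
      · rw [hxj, hyj]
      · rw [hxj, gj] at hxy; exact absurd hxy.symm (gmem y hy hyj).2.1
      · rw [hyj, gj] at hxy; exact absurd hxy (gmem x hx hxj).2.1
      · rw [gR x hx hxj, gR y hy hyj] at hxy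
        simpa using hf hxy
    · exfalso
      rw [gU y hy] at hxy
      by_cases hxj : x = j
      · rw [hxj, gj] at hxy; subst hxy; contradiction
      · have := (gmem x hx hxj).2.2; rw [hxy] at this; contradiction
    · exfalso
      rw [gU x hx] at hxy
      by_cases hyj : y = j
      · rw [hyj, gj] at hxy; subst hxy; contradiction
      · have := (gmem y hy hyj).2.2; rw [← hxy] at this; contradiction
    · rwa [gU x hx, gU y hy] at hxy
  exact ⟨Equiv.ofBijective g (Finite.injective_iff_bijective.1 ginj), gj,
    fun i h1 h2 ↦ (gmem i h1 h2).1, gU⟩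

open Finset in
/-- A rainbow matching missing only the index `s` can be turned into a perfect one. -/
lemma exists_perm_of_almost {ι : Type*} [Fintype ι] [DecidableEq ι] (N : ι → ι → Finset ι)
    (hrow : ∀ c x, Fintype.card ι ≤ 2 * #(N c x))
    (hcol : ∀ c y, Fintype.card ι < 2 * #{x | y ∈ N c x})
    (s : ι) (hs : ∀ i, i ≠ s → i ∈ N i i) :
    ∃ σ τ : Equiv.Perm ι, ∀ c, τ c ∈ N c (σ c) := by
  by_contra hno
  have hn : 0 < Fintype.card ι := Fintype.card_pos_iff.2 ⟨s⟩
  obtain ⟨S, hS⟩ : ∃ S : Finset ι, #(S.biUnion fun i ↦ N i i) < #S := by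
    by_contra! hall
    obtain ⟨f, hf, hfN⟩ := (Finset.all_card_le_biUnion_card_iff_exists_injective _).1 hall
    exact hno ⟨1, Equiv.ofBijective f (Finite.injective_iff_bijective.1 hf), hfN⟩
  have hsubS : S.erase s ⊆ S.biUnion fun i ↦ N i i := fun i hi ↦
    mem_biUnion.2 ⟨i, (mem_erase.1 hi).2, hs i (mem_erase.1 hi).1⟩
  have hSe := pred_card_le_card_erase (s := S) (a := s)
  have hSeq : S.erase s = S.biUnion fun i ↦ N i i :=
    eq_of_subset_of_card_le hsubS (by omega)
  have hSne : (S.erase s).Nonempty := by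
    obtain ⟨i, hi⟩ : S.Nonempty := card_pos.1 (by omega)
    rw [hSeq]
    have := hrow i i
    exact (card_pos.1 (by omega)).mono (subset_biUnion_of_mem (fun i ↦ N i i) hi)
  obtain ⟨R, ⟨hRne, hsR, hRcl⟩, hRmin⟩ : ∃ R : Finset ι,
      (R.Nonempty ∧ s ∉ R ∧ (R.biUnion fun i ↦ N i i) ⊆ R) ∧
      ∀ A ⊂ R, (A.biUnion fun i ↦ N i i) ⊆ A → A = ∅ := by
    have hex : ∃ R : Finset ι, R.Nonempty ∧ s ∉ R ∧ (R.biUnion fun i ↦ N i i) ⊆ R :=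
      ⟨S.erase s, hSne, by simp,
        (biUnion_subset_biUnion_of_subset_left _ (erase_subset s S)).trans hSeq.ge⟩
    obtain ⟨R, hR⟩ := exists_minimal_of_wellFoundedLT _ hex
    refine ⟨R, hR.prop, fun A hA hAcl ↦ ?_⟩
    by_contra hne
    exact hR.not_prop_of_lt hA ⟨nonempty_iff_ne_empty.2 hne, fun h ↦ hR.prop.2.1 (hA.1 h), hAcl⟩
  have hloop : ∀ i ∈ R, i ∈ N i i := fun i hi ↦ hs i (by rintro rfl; contradiction)
  have hNR : ∀ i ∈ R, N i i ⊆ R := fun i hi ↦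
    (subset_biUnion_of_mem (fun i ↦ N i i) hi).trans hRcl
  have hRcard : Fintype.card ι ≤ 2 * #R := by
    obtain ⟨i, hi⟩ := hRne
    have := card_le_card (hNR i hi)
    have := hrow i i
    omega
  obtain ⟨j, hjR, hj⟩ : ∃ j ∈ R, s ∈ N s j := by
    by_contra! hh
    have hsub : ({x | s ∈ N s x} : Finset ι) ⊆ Rᶜ := by
      intro x hx
      rw [mem_filter] at hx
      rw [mem_compl]
      exact fun h ↦ hh x h hx.2
    have h1 := card_le_card hsub
    have h2 := hcol s s
    rw [card_compl] at h1
    omega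
  have hjs : j ≠ s := by rintro rfl; contradiction
  have hτ := fun c (hc : c ∈ R) ↦ exists_perm_of_minimal_closed hRcl hloop hRmin hjR hc
  have hτ' : ∀ τ : Equiv.Perm ι, (∀ i ∈ R, i ≠ j → τ i ∈ N i i) → (∀ i ∉ R, τ i = i) →
      ∀ i, i ≠ s → i ≠ j → τ i ∈ N i i := by
    intro τ h1 h2 i his hij
    by_cases hi : i ∈ R
    · exact h1 i hi hij
    · rw [h2 i hi]; exact hs i his
  have hjsR : ¬ ∃ c ∈ N j s, c ∉ Rᶜ := by
    rintro ⟨c, hc, hcR⟩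
    obtain ⟨τ, h1, h2, h3⟩ := hτ c (by simpa using hcR)
    refine hno ⟨Equiv.swap s j, τ, fun i ↦ ?_⟩
    by_cases his : i = s
    · rw [his, Equiv.swap_apply_left, h3 s hsR]; exact hj
    by_cases hij : i = j
    · rw [hij, Equiv.swap_apply_right, h1]; exact hc
    rw [Equiv.swap_apply_of_ne_of_ne his hij]
    exact hτ' τ h2 h3 i his hij
  have hhalf : 2 * #R = Fintype.card ι := by
    have h1 := hrow j s
    have h2 : #(N j s) ≤ #Rᶜ := card_le_card (by simpa [subset_iff] using hjsR)
    have h3 := card_le_univ R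
    rw [card_compl] at h2
    omega
  have hhalf' : 2 * #Rᶜ = Fintype.card ι := by rw [card_compl]; omega
  have hNjs : N j s = Rᶜ := eq_of_forall_mem_of_card_half hhalf' (hrow j s) hjsR
  have hNii : ∀ i ∈ R, N i i = R := fun i hi ↦
    eq_of_subset_of_card_le (hNR i hi) (by have := hrow i i; omega)
  have hsjs : s ∈ N j s := by rw [hNjs, mem_compl]; exact hsR
  have hNsj : N s j = Rᶜ := by
    apply eq_of_forall_mem_of_card_half hhalf' (hrow s j)
    rintro ⟨c, hc, hcR⟩
    obtain ⟨τ, h1, h2, h3⟩ := hτ c (by simpa using hcR)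
    refine hno ⟨Equiv.swap s j, (Equiv.swap s j).trans τ, fun i ↦ ?_⟩
    rw [Equiv.trans_apply]
    by_cases his : i = s
    · rw [his, Equiv.swap_apply_left, h1]; exact hc
    by_cases hij : i = j
    · rw [hij, Equiv.swap_apply_right, h3 s hsR]; exact hsjs
    rw [Equiv.swap_apply_of_ne_of_ne his hij]
    exact hτ' τ h2 h3 i his hij
  have hNuu : ∀ u ∉ R, u ≠ s → N u u = Rᶜ := by
    intro u hu hus
    apply eq_of_forall_mem_of_card_half hhalf' (hrow u u)
    rintro ⟨c, hc, hcR⟩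
    obtain ⟨τ, h1, h2, h3⟩ := hτ c (by simpa using hcR)
    have huj : u ≠ j := by rintro rfl; contradiction
    refine hno ⟨Equiv.swap s j, ((Equiv.swap s j).trans (Equiv.swap u j)).trans τ, fun i ↦ ?_⟩
    simp only [Equiv.trans_apply]
    by_cases his : i = s
    · rw [his, Equiv.swap_apply_left, Equiv.swap_apply_right, h3 u hu, hNsj, mem_compl]
      exact hu
    by_cases hij : i = j
    · rw [hij, Equiv.swap_apply_right, Equiv.swap_apply_of_ne_of_ne hus.symm hjs.symm, h3 s hsR]
      exact hsjs
    rw [Equiv.swap_apply_of_ne_of_ne his hij]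
    by_cases hiu : i = u
    · rw [hiu, Equiv.swap_apply_left, h1]; exact hc
    rw [Equiv.swap_apply_of_ne_of_ne hiu hij]
    exact hτ' τ h2 h3 i his hij
  have hNss : N s s = R := by
    apply eq_of_forall_mem_of_card_half hhalf (hrow s s)
    rintro ⟨w, hw, hwR⟩
    refine hno ⟨1, Equiv.swap s w, fun i ↦ ?_⟩
    rw [Equiv.Perm.one_apply]
    by_cases his : i = s
    · rw [his, Equiv.swap_apply_left]; exact hw
    by_cases hiw : i = w
    · rw [hiw, Equiv.swap_apply_right, hNuu w hwR (hiw ▸ his), mem_compl]; exact hsR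
    rw [Equiv.swap_apply_of_ne_of_ne his hiw]
    exact hs i his
  refine hno (exists_perm_of_halves N hrow hcol (P := insert s R) hhalf
    (card_insert_of_notMem hsR) ?_ ?_)
  · intro i hi
    rcases mem_insert.1 hi with rfl | hi
    · exact hNss
    · exact hNii i hi
  · intro i hi
    rw [mem_insert, not_or] at hi
    exact hNuu i hi.2 hi.1

open Finset in
/-- The perfect matchings of a 3-partite 3-graph, parametrized by the middle side. -/
lemma exists_isPerfectMatching3_iff {V1 V2 V3 : Type*} [Fintype V2]
    [DecidableEq V1] [DecidableEq V2] [DecidableEq V3] (E : Finset (V1 × V2 × V3)) :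
    (∃ M, IsPerfectMatching3 E M) ↔
      ∃ (f : V2 ≃ V1) (g : V2 ≃ V3), ∀ v, (f v, v, g v) ∈ E := by
  constructor
  · rintro ⟨M, hME, h1, h2, h3⟩
    choose e he heu using h2
    have hb1 : Function.Bijective fun v ↦ (e v).1 := by
      constructor
      · intro v w hvw
        have := (h1 (e v).1).unique ⟨(he v).1, rfl⟩ ⟨(he w).1, hvw.symm⟩
        rw [← (he v).2, this, (he w).2]
      · intro x
        obtain ⟨y, ⟨hy, rfl⟩, -⟩ := h1 x
        exact ⟨y.2.1, congrArg Prod.fst (heu _ y ⟨hy, rfl⟩).symm⟩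
    have hb3 : Function.Bijective fun v ↦ (e v).2.2 := by
      constructor
      · intro v w hvw
        have := (h3 (e v).2.2).unique ⟨(he v).1, rfl⟩ ⟨(he w).1, hvw.symm⟩
        rw [← (he v).2, this, (he w).2]
      · intro x
        obtain ⟨y, ⟨hy, rfl⟩, -⟩ := h3 x
        exact ⟨y.2.1, congrArg (fun e ↦ e.2.2) (heu _ y ⟨hy, rfl⟩).symm⟩
    refine ⟨Equiv.ofBijective _ hb1, Equiv.ofBijective _ hb3, fun v ↦ ?_⟩
    have hv : ((e v).1, v, (e v).2.2) = e v := Prod.ext rfl (Prod.ext (he v).2.symm rfl)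
    simp only [Equiv.ofBijective_apply, hv]
    exact hME (he v).1
  · rintro ⟨f, g, hE⟩
    refine ⟨univ.image fun v ↦ (f v, v, g v), ?_, fun x ↦ ?_, fun x ↦ ?_, fun x ↦ ?_⟩
    · intro e he
      obtain ⟨v, -, rfl⟩ := mem_image.1 he
      exact hE v
    · refine ⟨(f (f.symm x), f.symm x, g (f.symm x)), ⟨by simp, by simp⟩, ?_⟩
      rintro e ⟨he, rfl⟩
      obtain ⟨v, -, rfl⟩ := mem_image.1 he
      simp
    · refine ⟨(f x, x, g x), ⟨by simp, by simp⟩, ?_⟩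
      rintro e ⟨he, rfl⟩
      obtain ⟨v, -, rfl⟩ := mem_image.1 he
      simp
    · refine ⟨(f (g.symm x), g.symm x, g (g.symm x)), ⟨by simp, by simp⟩, ?_⟩
      rintro e ⟨he, rfl⟩
      obtain ⟨v, -, rfl⟩ := mem_image.1 he
      simp

theorem stmt_0 {V1 V2 V3 : Type*} [Fintype V1] [Fintype V2] [Fintype V3]
    [DecidableEq V1] [DecidableEq V2] [DecidableEq V3]
    (n : ℕ)
    (hV1 : Fintype.card V1 = n) (hV2 : Fintype.card V2 = n)
    (hV3 : Fintype.card V3 = n)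
    (E : Finset (V1 × V2 × V3))
    (h23 : ∀ u : V2, ∀ v : V3,
      (n : ℝ) / 2 < ((E.filter (fun e => e.2.1 = u ∧ e.2.2 = v)).card : ℝ))
    (h12 : ∀ u : V1, ∀ v : V2,
      (n : ℝ) / 2 ≤ ((E.filter (fun e => e.1 = u ∧ e.2.1 = v)).card : ℝ)) :
    ∃ M : Finset (V1 × V2 × V3), IsPerfectMatching3 E M := by
  induction hk : Eᶜ.card using Nat.strong_induction_on generalizing E with
  | _ k ih =>
  rw [exists_isPerfectMatching3_iff]
  by_cases hfull : ∀ e, e ∈ E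
  · exact ⟨Fintype.equivOfCardEq (hV2.trans hV1.symm), Fintype.equivOfCardEq (hV2.trans hV3.symm),
      fun v ↦ hfull _⟩
  push Not at hfull
  obtain ⟨⟨x, s, z⟩, he⟩ := hfull
  have hsub := Finset.subset_insert (x, s, z) E
  have hlt : (insert (x, s, z) E)ᶜ.card < k := by
    rw [← hk]
    apply Finset.card_lt_card
    rw [Finset.compl_ssubset_compl]
    exact Finset.ssubset_insert he
  obtain ⟨f, g, hfg⟩ := (exists_isPerfectMatching3_iff _).1 (ih _ hlt (insert (x, s, z) E)
    (fun u v ↦ (h23 u v).trans_le (Nat.cast_le.2 (Finset.card_le_card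
      (Finset.filter_subset_filter _ hsub))))
    (fun u v ↦ (h12 u v).trans (Nat.cast_le.2 (Finset.card_le_card
      (Finset.filter_subset_filter _ hsub)))) rfl)
  have hrow : ∀ c i : V2, Fintype.card V2 ≤
      2 * (Finset.univ.filter fun y : V2 ↦ (f i, c, g y) ∈ E).card := by
    intro c i
    have h := h12 (f i) c
    have hle : (E.filter (fun e => e.1 = f i ∧ e.2.1 = c)).card ≤
        (Finset.univ.filter fun y : V2 ↦ (f i, c, g y) ∈ E).card := by
      apply Finset.card_le_card_of_injOn fun e ↦ g.symm e.2.2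
      · rintro ⟨a, b, d⟩ hd
        simp only [Finset.coe_filter, Set.mem_ofPred_eq] at hd
        obtain ⟨hd, rfl, rfl⟩ := hd
        simpa using hd
      · rintro ⟨a, b, d⟩ hd ⟨a', b', d'⟩ hd' hdd
        simp only [Finset.coe_filter, Set.mem_ofPred_eq] at hd hd'
        simp only [EmbeddingLike.apply_eq_iff_eq] at hdd
        simp [hd.2, hd'.2, hdd]
    rw [hV2]
    have : (n : ℝ) ≤ 2 * (E.filter (fun e => e.1 = f i ∧ e.2.1 = c)).card := by linarith
    have : n ≤ 2 * (E.filter (fun e => e.1 = f i ∧ e.2.1 = c)).card := by exact_mod_cast this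
    omega
  have hcol : ∀ c y : V2, Fintype.card V2 <
      2 * (Finset.univ.filter fun i : V2 ↦ (f i, c, g y) ∈ E).card := by
    intro c y
    have h := h23 c (g y)
    have hle : (E.filter (fun e => e.2.1 = c ∧ e.2.2 = g y)).card ≤
        (Finset.univ.filter fun i : V2 ↦ (f i, c, g y) ∈ E).card := by
      apply Finset.card_le_card_of_injOn fun e ↦ f.symm e.1
      · rintro ⟨a, b, d⟩ hd
        simp only [Finset.coe_filter, Set.mem_ofPred_eq] at hd
        obtain ⟨hd, rfl, rfl⟩ := hd
        simpa using hd
      · rintro ⟨a, b, d⟩ hd ⟨a', b', d'⟩ hd' hdd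
        simp only [Finset.coe_filter, Set.mem_ofPred_eq] at hd hd'
        simp only [EmbeddingLike.apply_eq_iff_eq] at hdd
        simp [hd.2, hd'.2, hdd]
    rw [hV2]
    have : (n : ℝ) < 2 * (E.filter (fun e => e.2.1 = c ∧ e.2.2 = g y)).card := by linarith
    have : n < 2 * (E.filter (fun e => e.2.1 = c ∧ e.2.2 = g y)).card := by exact_mod_cast this
    omega
  obtain ⟨σ, τ, hστ⟩ := exists_perm_of_almost
    (fun c i ↦ Finset.univ.filter fun y : V2 ↦ (f i, c, g y) ∈ E) hrow
    (by simpa using hcol) s (by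
      intro i his
      have := hfg i
      simp only [Finset.mem_insert, Prod.mk.injEq, his, false_and, and_false, false_or] at this
      simpa using this)
  exact ⟨σ.trans f, τ.trans g, fun v ↦ by simpa using hστ v⟩
end

section
/- Let $r \ge 2$ and let $H$ be an $n$-balanced $r$-partite $r$-graph with sides $V_1, \ldots, V_r$. Suppose that every legal $(r-1)$-tuple contained in $V_2 \cup V_3 \cup \cdots \cup V_r$ has degree strictly greater than $n/2$, and every legal $(r-1)$-tuple contained in $V_1 \cup \cdots \cup V_{r-1}$ has degree at least $n/2$. Then $H$ has a perfect matching. -/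
/-- The degree of the legal `(r-1)`-tuple obtained by restricting the full tuple `f`
to the sides other than `V j`: the number of edges agreeing with `f` outside side `j`. -/
def degAvoiding {r : ℕ} {V : Fin r → Type*} [∀ i, DecidableEq (V i)]
    (E : Finset (∀ i, V i)) (j : Fin r) (f : ∀ i, V i) : ℕ :=
  (E.filter (fun e => ∀ i, i ≠ j → e i = f i)).card

/-- A perfect matching of an `r`-partite `r`-graph with edge set `E ⊆ V 0 × ⋯ × V (r-1)`:
a subset of `E` such that every vertex of every side lies in exactly one of its edges
(this forces the edges to be pairwise disjoint and to cover all vertices). -/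
def IsPerfectMatchingR {r : ℕ} {V : Fin r → Type*}
    (E M : Finset (∀ i, V i)) : Prop :=
  M ⊆ E ∧ ∀ (i : Fin r) (v : V i), ∃! e, e ∈ M ∧ e i = v

theorem exists_mem_inter_of_card {α : Type*} [Fintype α] (P Q : α → Prop)
    [DecidablePred P] [DecidablePred Q]
    (h : 2 * Fintype.card α
      < 2 * (Finset.univ.filter P).card + 2 * (Finset.univ.filter Q).card) :
    ∃ a, P a ∧ Q a := by
  classical
  by_contra! hPQ
  have hd : Disjoint (Finset.univ.filter P) (Finset.univ.filter Q) :=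
    Finset.disjoint_filter.mpr fun a _ => hPQ a
  have := (Finset.card_union_of_disjoint hd).symm.trans_le (Finset.card_le_univ _)
  omega

open Classical in
/-- If all diagonal triples except possibly `(o, o, o)` are edges, some index `j` can be used
as first coordinate against at least half of the diagonal pairs `(i, i)` with `i ≠ o`. -/
theorem exists_large_diagonal_degree {α : Type*} [Fintype α] (E : α → α → α → Prop) (o : α)
    (hα : 2 ≤ Fintype.card α)
    (h1 : ∀ y z, Fintype.card α < 2 * (Finset.univ.filter fun x => E x y z).card) :
    ∃ j, Fintype.card α ≤ 2 * (Finset.univ.filter fun i => i ≠ o ∧ E j i i).card := by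
  by_contra! hlt
  have hdc := Finset.sum_card_bipartiteAbove_eq_sum_card_bipartiteBelow
    (s := (Finset.univ : Finset α)) (t := Finset.univ.erase o) (fun j i => E j i i)
  have hup : ∀ j ∈ (Finset.univ : Finset α),
      2 * (Finset.bipartiteAbove (fun j i => E j i i) (Finset.univ.erase o) j).card
        ≤ Fintype.card α - 1 := by
    intro j _
    have : Finset.bipartiteAbove (fun j i => E j i i) (Finset.univ.erase o) j
        = Finset.univ.filter fun i => i ≠ o ∧ E j i i := by
      ext i; simp [Finset.bipartiteAbove]
    rw [this]
    have := hlt j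
    omega
  have hlo : ∀ i ∈ (Finset.univ : Finset α).erase o, Fintype.card α + 1 ≤
      2 * (Finset.bipartiteBelow (fun j i => E j i i) Finset.univ i).card :=
    fun i _ => h1 i i
  have hS := Finset.sum_le_card_nsmul _ _ _ hup
  have hT := Finset.card_nsmul_le_sum _ _ _ hlo
  rw [← Finset.mul_sum] at hS hT
  rw [hdc] at hS
  have := hT.trans hS
  rw [Finset.card_erase_of_mem (Finset.mem_univ o), Finset.card_univ] at this
  obtain ⟨m, hm⟩ := Nat.exists_eq_add_of_le hα
  rw [hm] at this
  simp only [smul_eq_mul] at this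
  have h' : 2 + m - 1 = m + 1 := by omega
  rw [h'] at this
  nlinarith

open Classical in
theorem exists_perm_of_diagonal {α : Type*} [Fintype α] (E : α → α → α → Prop) (o : α)
    (h1 : ∀ y z, Fintype.card α < 2 * (Finset.univ.filter fun x => E x y z).card)
    (h2 : ∀ x y, Fintype.card α ≤ 2 * (Finset.univ.filter fun z => E x y z).card)
    (hd : ∀ i, i ≠ o → E i i i) :
    ∃ p q : Equiv.Perm α, ∀ y, E (p y) y (q y) := by
  by_cases hoo : E o o o
  · exact ⟨1, 1, fun y => by by_cases h : y = o <;> [exact h ▸ hoo; exact hd y h]⟩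
  have hα : 2 ≤ Fintype.card α := by
    by_contra! hlt
    have : Subsingleton α := Fintype.card_le_one_iff_subsingleton.mp (by omega)
    have hpos : 0 < (Finset.univ.filter fun x => E x o o).card := by have := h1 o o; omega
    obtain ⟨x, hx⟩ := Finset.card_pos.mp hpos
    rw [Subsingleton.elim x o] at hx
    exact hoo (Finset.mem_filter.mp hx).2
  obtain ⟨j, hj⟩ := exists_large_diagonal_degree E o hα h1
  by_cases hjo : j = o
  · subst hjo
    obtain ⟨i, ⟨hi, hji⟩, hi'⟩ := exists_mem_inter_of_card (fun i => i ≠ j ∧ E j i i)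
      (fun i => E i j j) (by have := h1 j j; omega)
    refine ⟨Equiv.swap j i, 1, fun y => ?_⟩
    simp only [Equiv.swap_apply_def, Equiv.Perm.one_apply]
    grind
  obtain ⟨l, hl, hlj⟩ := exists_mem_inter_of_card (fun l => E o o l) (fun l => E l j j)
    (by have := h1 j j; have := h2 o o; omega)
  obtain ⟨i, ⟨hi, hji⟩, hil⟩ := exists_mem_inter_of_card (fun i => i ≠ o ∧ E j i i)
    (fun i => E i l o) (by have := h1 l o; omega)
  have hlo : l ≠ o := by rintro rfl; exact hoo hl
  by_cases h : i = l
  · refine ⟨1, Equiv.swap o l, fun y => ?_⟩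
    simp only [Equiv.swap_apply_def, Equiv.Perm.one_apply]
    grind
  by_cases h' : i = j
  · refine ⟨Equiv.swap l j, Equiv.swap o l, fun y => ?_⟩
    simp only [Equiv.swap_apply_def]
    grind
  refine ⟨Equiv.swap l j * Equiv.swap l i, Equiv.swap o l, fun y => ?_⟩
  simp only [Equiv.swap_apply_def, Equiv.Perm.mul_apply]
  grind

theorem card_filter_perm {α : Type*} [Fintype α] (σ : Equiv.Perm α) (P : α → Prop)
    [DecidablePred P] [DecidablePred fun a => P (σ a)] :
    (Finset.univ.filter fun a => P (σ a)).card = (Finset.univ.filter P).card :=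
  Finset.card_bijective σ σ.bijective (by simp)

open Classical in
/-- The three-sided case, with all sides identified with `α`. -/
theorem exists_perm_of_degrees {α : Type*} [Fintype α] (E : Set (α × α × α))
    (h1 : ∀ y z, Fintype.card α < 2 * (Finset.univ.filter fun x => (x, y, z) ∈ E).card)
    (h2 : ∀ x y, Fintype.card α ≤ 2 * (Finset.univ.filter fun z => (x, y, z) ∈ E).card) :
    ∃ p q : Equiv.Perm α, ∀ y, (p y, y, q y) ∈ E := by
  induction E using WellFoundedGT.induction with
  | ind E ih =>
  by_cases hE : ∀ t, t ∈ E
  · exact ⟨1, 1, fun y => hE _⟩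
  push Not at hE
  obtain ⟨⟨x, y, z⟩, ht⟩ := hE
  obtain ⟨p, q, hpq⟩ := ih (insert (x, y, z) E) (Set.ssubset_insert ht)
    (fun b c => (h1 b c).trans_le <| Nat.mul_le_mul_left 2 <| Finset.card_le_card
      fun _ h => by
        simp only [Finset.mem_filter_univ] at h ⊢
        exact Set.mem_insert_of_mem _ h)
    (fun a b => (h2 a b).trans <| Nat.mul_le_mul_left 2 <| Finset.card_le_card
      fun _ h => by
        simp only [Finset.mem_filter_univ] at h ⊢
        exact Set.mem_insert_of_mem _ h)
  obtain ⟨p', q', h⟩ := exists_perm_of_diagonal (fun a b c => (p a, b, q c) ∈ E) y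
    (fun b c => by rw [card_filter_perm p fun a => (a, b, q c) ∈ E]; exact h1 b (q c))
    (fun a b => by rw [card_filter_perm q fun c => (p a, b, c) ∈ E]; exact h2 (p a) b)
    (fun i hi => (hpq i).resolve_left fun h => hi (congrArg (fun t => t.2.1) h))
  exact ⟨p * p', q * q', h⟩

/-- If the edges avoiding side `j` of `f` all lie among the tuples `g a`, then the degree is at
most the number of `a` for which `g a` is an edge. -/
theorem degAvoiding_le_card_filter {r : ℕ} {V : Fin r → Type*} [∀ i, DecidableEq (V i)]
    {α : Type*} [Fintype α] (E : Finset (∀ i, V i)) (j : Fin r) (f : ∀ i, V i)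
    (g : α → ∀ i, V i) [DecidablePred fun a => g a ∈ E]
    (hg : ∀ a i, i ≠ j → g a i = f i) (hs : ∀ v, ∃ a, g a j = v) :
    degAvoiding E j f ≤ (Finset.univ.filter fun a => g a ∈ E).card := by
  classical
  refine (Finset.card_le_card fun e he => ?_).trans
    (Finset.card_image_le (s := Finset.univ.filter fun a => g a ∈ E) (f := g))
  obtain ⟨heE, he⟩ := Finset.mem_filter.mp he
  obtain ⟨a, ha⟩ := hs (e j)
  have hae : g a = e := by
    funext i
    by_cases h : i = j
    · subst h; exact ha
    · rw [hg a i h, he i h]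
  exact Finset.mem_image.mpr ⟨a, by simpa [hae] using heE, hae⟩

theorem stmt_1 (r n : ℕ) (hr : 2 ≤ r) (V : Fin r → Type*)
    [∀ i, Fintype (V i)] [∀ i, DecidableEq (V i)]
    (hV : ∀ i, Fintype.card (V i) = n)
    (E : Finset (∀ i, V i))
    -- every legal (r-1)-tuple contained in V_2 ∪ ⋯ ∪ V_r (i.e. avoiding side 1)
    -- has degree strictly greater than n/2
    (h1 : ∀ f : ∀ i, V i,
      (n : ℝ) / 2 < (degAvoiding E ⟨0, by omega⟩ f : ℝ))
    -- every legal (r-1)-tuple contained in V_1 ∪ ⋯ ∪ V_{r-1} (i.e. avoiding side r)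
    -- has degree at least n/2
    (h2 : ∀ f : ∀ i, V i,
      (n : ℝ) / 2 ≤ (degAvoiding E ⟨r - 1, by omega⟩ f : ℝ)) :
    ∃ M : Finset (∀ i, V i), IsPerfectMatchingR E M := by
  classical
  have e : ∀ i, Fin n ≃ V i := fun i => (Fintype.equivFinOfCardEq (hV i)).symm
  set s : Fin r := ⟨0, by omega⟩
  set t : Fin r := ⟨r - 1, by omega⟩
  have hst : t ≠ s := by simp only [s, t, ne_eq, Fin.mk.injEq]; omega
  let g : Fin n → Fin n → Fin n → ∀ i, V i :=
    fun x y z i => e i (if i = s then x else if i = t then z else y)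
  obtain ⟨p, q, hpq⟩ := exists_perm_of_degrees {a : Fin n × Fin n × Fin n | g a.1 a.2.1 a.2.2 ∈ E}
    (fun y z => by
      have hle := degAvoiding_le_card_filter E s (g y y z) (fun x => g x y z)
        (fun a i hi => by simp [g, hi])
        (fun v => ⟨(e s).symm v, by simp [g]⟩)
      have hlt := h1 (g y y z)
      rw [div_lt_iff₀ two_pos] at hlt
      have hlt' : n < degAvoiding E s (g y y z) * 2 := by exact_mod_cast hlt
      simp only [Set.mem_ofPred_eq, Fintype.card_fin]
      omega)
    (fun x y => by
      have hle := degAvoiding_le_card_filter E t (g x y y) (fun z => g x y z)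
        (fun a i hi => by simp [g, hi])
        (fun v => ⟨(e t).symm v, by simp [g, hst]⟩)
      have hlt := h2 (g x y y)
      rw [div_le_iff₀ two_pos] at hlt
      have hlt' : n ≤ degAvoiding E t (g x y y) * 2 := by exact_mod_cast hlt
      simp only [Set.mem_ofPred_eq, Fintype.card_fin]
      omega)
  refine ⟨Finset.univ.image fun y => g (p y) y (q y), ?_, fun i v => ?_⟩
  · intro a ha
    obtain ⟨y, -, rfl⟩ := Finset.mem_image.mp ha
    exact hpq y
  · have hb : Function.Bijective fun y => g (p y) y (q y) i := by
      by_cases his : i = s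
      · simp only [g, his, if_true]
        exact (e i).bijective.comp p.bijective
      · by_cases hit : i = t
        · simp only [g, hit, hst, if_true, if_false]
          exact (e i).bijective.comp q.bijective
        · simp only [g, his, hit, if_false]
          exact (e i).bijective
    obtain ⟨y, hy, hu⟩ := hb.existsUnique v
    refine ⟨g (p y) y (q y), ⟨Finset.mem_image_of_mem _ (Finset.mem_univ y), hy⟩, ?_⟩
    rintro a ⟨ha, hav⟩
    obtain ⟨y', -, rfl⟩ := Finset.mem_image.mp ha
    rw [hu y' hav]
end

section
/- Let $r \ge 2$ and let $H$ be an $n$-balanced $r$-partite $r$-graph. If every legal $(r-1)$-tuple (one vertex from each of $r-1$ distinct sides) has degree strictly greater than $n/2$, then $H$ has a perfect matching. -/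
open Finset in
/-- If almost all diagonal triples are edges, in a tripartite 3-graph whose pair degrees into the
first two sides exceed half, then some in-degree of `l ↦ (l, k, l)` is large. -/
theorem exists_large_diagonal_degree_s2 {α : Type*} [Fintype α] [DecidableEq α]
    (E : α → α → α → Prop) [∀ a b c, Decidable (E a b c)] (z : α) (d : ℕ)
    (hdiag : ∀ i, i ≠ z → E i i i) (hb : ∀ a c, d ≤ #{b | E a b c})
    (hz : ∃ j, j ≠ z ∧ ¬ E j z j) :
    ∃ k, k ≠ z ∧ d ≤ #{l | l ≠ z ∧ l ≠ k ∧ E l k l} + 1 := by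
  by_contra! hlt
  have hcount := sum_card_bipartiteAbove_eq_sum_card_bipartiteBelow
    (s := univ.erase z) (t := univ) (fun l k => E l k l)
  have hlow : #(univ.erase z) * d ≤
      ∑ l ∈ univ.erase z, #(univ.bipartiteAbove (fun l k => E l k l) l) := by
    rw [← smul_eq_mul]
    exact card_nsmul_le_sum _ _ _ fun l _ => hb l l
  have hcol : ∀ k ∈ univ.erase z,
      #((univ.erase z).bipartiteBelow (fun l k => E l k l) k) + 1 ≤ d := by
    intro k hk
    have hkz : k ≠ z := ne_of_mem_erase hk
    have heq : (univ.erase z).bipartiteBelow (fun l k => E l k l) k =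
        insert k ({l | l ≠ z ∧ l ≠ k ∧ E l k l} : Finset α) := by
      ext l
      have := hdiag k hkz
      simp only [mem_bipartiteBelow, mem_erase, mem_univ, mem_insert, mem_filter]
      by_cases h : l = k
      · subst h; simp [hkz, this]
      · simp [h]
    rw [heq, card_insert_of_notMem (by simp)]
    exact hlt k hkz
  have hcolz : #((univ.erase z).bipartiteBelow (fun l k => E l k l) z) < #(univ.erase z) := by
    obtain ⟨j, hj, hE⟩ := hz
    exact card_lt_card (filter_ssubset.2 ⟨j, by simp [hj], hE⟩)
  have hup : ∑ k ∈ univ.erase z,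
      (#((univ.erase z).bipartiteBelow (fun l k => E l k l) k) + 1) ≤ #(univ.erase z) * d := by
    rw [← smul_eq_mul]
    exact sum_le_card_nsmul _ _ _ hcol
  rw [sum_add_distrib, sum_const, smul_eq_mul, mul_one] at hup
  rw [← add_sum_erase univ _ (mem_univ z)] at hcount
  omega

open Finset in
/-- The augmentation step: a matching of a balanced tripartite 3-graph missing exactly one
vertex from each side can be turned into a perfect matching. -/
theorem exists_perms_of_diagonal {α : Type*} [Fintype α] [DecidableEq α]
    (E : α → α → α → Prop) [∀ a b c, Decidable (E a b c)] (z : α) (d : ℕ)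
    (hd : Fintype.card α < 2 * d) (hdiag : ∀ i, i ≠ z → E i i i)
    (hb : ∀ a c, d ≤ #{b | E a b c}) (ha : ∀ b c, d ≤ #{a | E a b c}) :
    ∃ σ τ : Equiv.Perm α, ∀ i, E (σ i) (τ i) i := by
  by_contra hno
  have no : ∀ σ τ : Equiv.Perm α, ¬ ∀ i, E (σ i) (τ i) i := fun σ τ h => hno ⟨σ, τ, h⟩
  have hzzz : ¬ E z z z := fun h => no 1 1 fun i => by
    by_cases hi : i = z
    · simpa [hi] using h
    · simpa using hdiag i hi
  have two : ∀ j, j ≠ z → E z j z → ¬ E j z j := by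
    intro j hj h1 h2
    apply no 1 (Equiv.swap z j)
    intro i
    simp only [Equiv.Perm.one_apply, Equiv.swap_apply_def]
    grind
  obtain ⟨k, hkz, hk⟩ := exists_large_diagonal_degree_s2 E z d hdiag hb (by
    obtain ⟨j, hj⟩ := card_pos.1 (show 0 < #{b | E z b z} by have := hb z z; omega)
    rw [mem_filter] at hj
    have hjz : j ≠ z := fun h => hzzz (h ▸ hj.2)
    exact ⟨j, hjz, two j hjz hj.2⟩)
  have inter : ∀ s t u : Finset α, s ⊆ u → t ⊆ u → #u < #s + #t → (s ∩ t).Nonempty := by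
    intro s t u hs ht h
    rw [nonempty_iff_ne_empty, ne_eq, ← disjoint_iff_inter_eq_empty]
    intro hdis
    have := card_le_card (union_subset hs ht)
    rw [card_union_of_disjoint hdis] at this
    omega
  have hkzk : ¬ E k z k := by
    intro h
    obtain ⟨l, hl⟩ := inter {l | l ≠ z ∧ l ≠ k ∧ E l k l} ({b | E z b z} : Finset α)
      (univ.erase z) (by intro; simp +contextual) (by intro; simp; grind) (by
        rw [card_erase_of_mem (mem_univ z), card_univ]
        have := hb z z
        have := Fintype.card_pos_iff.2 ⟨z⟩
        omega)
    simp only [mem_inter, mem_filter, mem_univ, true_and] at hl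
    apply no 1 (Equiv.swap z k * Equiv.swap z l)
    intro i
    simp only [Equiv.Perm.one_apply, Equiv.Perm.mul_apply, Equiv.swap_apply_def]
    grind
  have key : ∀ j, E j z k → E z j z → j ≠ z ∧ j ≠ k ∧ E k j j ∧ E j k j := by
    intro j h1 h2
    have hjz : j ≠ z := fun h => hzzz (h ▸ h2)
    have hjk : j ≠ k := fun h => hkzk (h ▸ h1)
    have hkkj : ¬ E k k j := by
      intro h
      apply no (Equiv.swap j k) (Equiv.swap z k * Equiv.swap z j)
      intro i
      simp only [Equiv.Perm.mul_apply, Equiv.swap_apply_def]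
      grind
    have hl : ∀ l, l ≠ z → l ≠ k → l ≠ j → E l k l → ¬ E k l j := by
      intro l hlz hlk hlj h3 h4
      apply no (Equiv.swap j k)
        (Equiv.swap z k * Equiv.swap z l * Equiv.swap z j)
      intro i
      simp only [Equiv.Perm.mul_apply, Equiv.swap_apply_def]
      grind
    have hcard : #({z, j, k}ᶜ : Finset α) + 3 = Fintype.card α := by
      rw [← card_compl_add_card ({z, j, k} : Finset α),
        card_eq_three.2 ⟨z, j, k, hjz.symm, hkz.symm, hjk, rfl⟩]
    have hbk := hb k j
    refine ⟨hjz, hjk, ?_⟩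
    by_contra hnot
    set A : Finset α := {l | l ≠ z ∧ l ≠ k ∧ E l k l} with hA
    set B : Finset α := {b | E k b j} with hB
    have hBk : k ∉ B := by simp [hB, hkkj]
    have hAz : z ∉ A := by simp [hA]
    have hAk : k ∉ A := by simp [hA]
    have hdisj : Disjoint (A.erase j) (B.erase j) := by
      rw [disjoint_left]
      intro l h3 h4
      simp only [hA, hB, mem_erase, mem_filter, mem_univ, true_and] at h3 h4
      exact hl l h3.2.1 h3.2.2.1 h3.1 h3.2.2.2 h4.2
    have hunion : A.erase j ∪ B.erase j ⊆ univ \ {j, k} := by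
      intro l h
      simp only [mem_union, mem_erase, mem_sdiff, mem_univ, mem_insert, mem_singleton] at h ⊢
      grind
    have hle := card_le_card hunion
    rw [card_union_of_disjoint hdisj, card_sdiff_of_subset (subset_univ _), card_pair hjk,
      card_univ] at hle
    have hor : j ∉ A ∨ j ∉ B := by
      simp only [hA, hB, mem_filter, mem_univ, true_and]
      tauto
    have hA1 := pred_card_le_card_erase (s := A) (a := j)
    have hB1 := pred_card_le_card_erase (s := B) (a := j)
    rcases hor with h | h
    · rw [erase_eq_of_notMem h] at *
      omega
    · rw [erase_eq_of_notMem h] at *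
      omega
  set J : Finset α := {j | E j z k} with hJ
  set K : Finset α := {j | E z j z} with hK
  have hJK := card_union_add_card_inter J K
  have hJd : d ≤ #J := ha z k
  have hKd : d ≤ #K := hb z z
  have hle := card_le_univ (J ∪ K)
  have hzkz : ¬ E z k z := by
    intro h
    obtain ⟨j, hj⟩ := card_pos.1 (show 0 < #(J ∩ K) by omega)
    simp only [hJ, hK, mem_inter, mem_filter, mem_univ, true_and] at hj
    have := key j hj.1 hj.2
    apply no (Equiv.swap j k) (Equiv.swap z k)
    intro i
    simp only [Equiv.swap_apply_def]
    grind
  have hlt : #(J ∪ K) < Fintype.card α := card_lt_univ_of_notMem (x := k) (by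
    simp [hJ, hK, hkzk, hzkz])
  obtain ⟨j, hj, j', hj', hne⟩ := one_lt_card.1 (show 1 < #(J ∩ K) by omega)
  simp only [hJ, hK, mem_inter, mem_filter, mem_univ, true_and] at hj hj'
  have h1 := key j hj.1 hj.2
  have h2 := key j' hj'.1 hj'.2
  apply no (Equiv.swap j k) (Equiv.swap z k * Equiv.swap z j')
  intro i
  simp only [Equiv.Perm.mul_apply, Equiv.swap_apply_def]
  grind

open Finset in
/-- A family of bipartite graphs `E · · c` on two copies of `α`, indexed by `c : α`, all of minimum
degree more than half of `card α`, has a rainbow perfect matching. -/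
theorem exists_rainbow_perfect_matching {α : Type*} [Fintype α] [DecidableEq α] (d : ℕ)
    (hd : Fintype.card α < 2 * d) (S : Finset (α × α × α))
    (hb : ∀ a c, d ≤ #{b | (a, b, c) ∈ S}) (ha : ∀ b c, d ≤ #{a | (a, b, c) ∈ S}) :
    ∃ σ τ : Equiv.Perm α, ∀ i, (σ i, τ i, i) ∈ S := by
  induction hm : #Sᶜ generalizing S with
  | zero =>
    have hS : S = univ := by rwa [card_eq_zero, compl_eq_empty_iff] at hm
    exact ⟨1, 1, by simp [hS]⟩
  | succ m ih =>
    obtain ⟨e, he⟩ := card_pos.1 (show 0 < #Sᶜ by omega)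
    obtain ⟨σ, τ, h⟩ := ih (insert e S)
      (fun a c => (hb a c).trans (card_le_card
        (monotone_filter_right _ fun _ _ h => mem_insert_of_mem h)))
      (fun b c => (ha b c).trans (card_le_card
        (monotone_filter_right _ fun _ _ h => mem_insert_of_mem h)))
      (by rw [compl_insert, card_erase_of_mem he]; omega)
    obtain ⟨σ', τ', h'⟩ := exists_perms_of_diagonal
      (fun a b c => (σ a, τ b, c) ∈ S) e.2.2 d hd
      (fun i hi => by
        rcases mem_insert.1 (h i) with h | h
        · exact absurd (congrArg (fun e => e.2.2) h) hi
        · exact h)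
      (fun a c => (hb (σ a) c).trans_eq (card_equiv τ.symm (by simp)))
      (fun b c => (ha (τ b) c).trans_eq (card_equiv σ.symm (by simp)))
    exact ⟨σ * σ', τ * τ', h'⟩

/-- The degree of a tuple avoiding side `j` counts the vertices of `V j` completing it. -/
theorem degAvoiding_eq_card_update {r : ℕ} {V : Fin r → Type*} [∀ i, Fintype (V i)]
    [∀ i, DecidableEq (V i)] (E : Finset (∀ i, V i)) (j : Fin r) (f : ∀ i, V i) :
    degAvoiding E j f = (Finset.univ.filter fun v => Function.update f j v ∈ E).card := by
  have hupd : ∀ e : ∀ i, V i, (∀ i, i ≠ j → e i = f i) → Function.update f j (e j) = e := by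
    intro e he
    rw [Function.update_eq_iff]
    exact ⟨rfl, fun i hi => (he i hi).symm⟩
  refine Finset.card_bij' (fun e _ => e j) (fun v _ => Function.update f j v) ?_ ?_ ?_ ?_
  · intro e he
    rw [Finset.mem_filter] at he
    simpa [hupd e he.2] using he.1
  · intro v hv
    simp only [Finset.mem_filter, Finset.mem_univ, true_and] at hv ⊢
    exact ⟨hv, fun i hi => Function.update_of_ne hi v f⟩
  · intro e he
    exact hupd e (Finset.mem_filter.1 he).2
  · intro v _
    simp

theorem stmt_2 (r n : ℕ) (hr : 2 ≤ r) (V : Fin r → Type*)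
    [∀ i, Fintype (V i)] [∀ i, DecidableEq (V i)]
    (hV : ∀ i, Fintype.card (V i) = n)
    (E : Finset (∀ i, V i))
    -- every legal (r-1)-tuple has degree strictly greater than n/2
    (hdeg : ∀ (j : Fin r) (f : ∀ i, V i),
      (n : ℝ) / 2 < (degAvoiding E j f : ℝ)) :
    ∃ M : Finset (∀ i, V i), IsPerfectMatchingR E M := by
  have hr0 : 0 < r := by omega
  set p : Fin r := ⟨0, hr0⟩ with hp
  set q : Fin r := ⟨1, by omega⟩ with hq
  have hpq : p ≠ q := by simp [hp, hq, Fin.ext_iff]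
  let ε : ∀ i, Fin n ≃ V i := fun i => (Fintype.equivFinOfCardEq (hV i)).symm
  let tuple : Fin n → Fin n → Fin n → ∀ i, V i := fun a b c =>
    Function.update (Function.update (fun i => ε i c) q (ε q b)) p (ε p a)
  let S : Finset (Fin n × Fin n × Fin n) := {x | tuple x.1 x.2.1 x.2.2 ∈ E}
  have hdeg' : ∀ j f, n / 2 + 1 ≤ degAvoiding E j f := by
    intro j f
    have h := hdeg j f
    rw [div_lt_iff₀ two_pos] at h
    have : n < degAvoiding E j f * 2 := by exact_mod_cast h
    omega
  obtain ⟨σ, τ, h⟩ := exists_rainbow_perfect_matching (n / 2 + 1)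
    (by rw [Fintype.card_fin]; omega) S
    (fun a c => by
      refine (hdeg' q (tuple a c c)).trans_eq ?_
      rw [degAvoiding_eq_card_update]
      refine Finset.card_equiv (ε q).symm fun v => ?_
      simp [S, tuple, Function.update_comm hpq])
    (fun b c => by
      refine (hdeg' p (tuple c b c)).trans_eq ?_
      rw [degAvoiding_eq_card_update]
      refine Finset.card_equiv (ε p).symm fun v => ?_
      simp [S, tuple])
  have hcoord : ∀ i, ∃ π : Fin n ≃ V i, ∀ c, tuple (σ c) (τ c) c i = π c := by
    intro i
    by_cases hip : i = p
    · subst hip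
      exact ⟨σ.trans (ε _), fun c => by simp [tuple]⟩
    by_cases hiq : i = q
    · subst hiq
      exact ⟨τ.trans (ε _), fun c => by simp [tuple, Function.update_of_ne hip]⟩
    · exact ⟨ε i, fun c => by simp [tuple, Function.update_of_ne hip, Function.update_of_ne hiq]⟩
  classical
  refine ⟨Finset.univ.image fun c => tuple (σ c) (τ c) c, ?_, ?_⟩
  · intro e he
    obtain ⟨c, -, rfl⟩ := Finset.mem_image.1 he
    simpa [S] using h c
  · intro i v
    obtain ⟨π, hπ⟩ := hcoord i
    refine ⟨tuple (σ (π.symm v)) (τ (π.symm v)) (π.symm v),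
      ⟨Finset.mem_image_of_mem _ (Finset.mem_univ _), by simp [hπ]⟩, ?_⟩
    rintro e ⟨he, hev⟩
    obtain ⟨c, -, rfl⟩ := Finset.mem_image.1 he
    rw [hπ] at hev
    rw [← hev, π.symm_apply_apply]
end
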